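/- Let p ∈ (−n, 1), ε ∈ (0, 1/3), and let μ be a Borel measure on S^{n-1} with dμ = f dH^{n-1} where τ_1 < f < τ_2 for constants τ_2 > τ_1 > 0. Let K_1 denote the family of convex bodies of volume one containing the origin. If for K ∈ K_1 there exists a closed set ω ⊂ S^{n-1} with H^{n-1}(ω) > 0 and S_K(ω) = 0, then there exists a convex body K̃ ∈ K_1 with Φ_ε(K̃, ξ(K̃)) < Φ_ε(K, ξ(K)). Consequently, any minimizer of K ↦ Φ_ε(K, ξ(K)) over K_1 is quasi-smooth. -/

import Mathlib

open MeasureTheory Metric Set Filter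
open scoped ENNReal RealInnerProductSpace NNReal

noncomputable section

abbrev Eu (n : ℕ) : Type := EuclideanSpace ℝ (Fin n)

def IsConvexBody {n : ℕ} (K : Set (Eu n)) : Prop :=
  Convex ℝ K ∧ IsCompact K ∧ (interior K).Nonempty

def suppFn {n : ℕ} (K : Set (Eu n)) (u : Eu n) : ℝ :=
  sSup ((fun x => ⟪x, u⟫) '' K)

def IsOuterNormal {n : ℕ} (K : Set (Eu n)) (x u : Eu n) : Prop :=
  ‖u‖ = 1 ∧ ∀ y ∈ K, ⟪y, u⟫ ≤ ⟪x, u⟫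

def gaussMap {n : ℕ} (K : Set (Eu n)) (x : Eu n) : Eu n :=
  open scoped Classical in
  if h : ∃ u, IsOuterNormal K x u then h.choose else 0

def lpSurf {n : ℕ} (p : ℝ) (K : Set (Eu n)) (ω : Set (Eu n)) : ℝ≥0∞ :=
  ∫⁻ x in {x ∈ frontier K | gaussMap K x ∈ ω},
    ENNReal.ofReal (⟪x, gaussMap K x⟫ ^ (1 - p)) ∂(μH[(n:ℝ) - 1])


/-- The function `φ` of Section 3: `φ(t) = t^p` for `p ∈ (0,1)`, `log t` for `p = 0`, and
`-t^p` for `p ∈ (-n,0)`. -/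
def phiFn (p : ℝ) (t : ℝ) : ℝ :=
  if 0 < p then t ^ p else if p = 0 then Real.log t else -(t ^ p)

/-- The modified energy density `φ_ε`: an increasing, strictly concave function on `(0,∞)`
with continuous negative second derivative that agrees with `φ` on `[3ε,∞)`, equals
`-t^{-q}` on `(0,ε]`, and satisfies `φ_ε(t) ≥ -t^{-q}` on `(0,1)`. -/
def IsPhiEps (p ε q : ℝ) (φ : ℝ → ℝ) : Prop :=
  StrictMonoOn φ (Set.Ioi 0) ∧
  StrictConcaveOn ℝ (Set.Ioi 0) φ ∧
  (∀ t ∈ Set.Ioi (0:ℝ), DifferentiableAt ℝ φ t ∧ DifferentiableAt ℝ (deriv φ) t ∧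
    deriv (deriv φ) t < 0) ∧
  ContinuousOn (deriv (deriv φ)) (Set.Ioi 0) ∧
  (∀ t : ℝ, 3 * ε ≤ t → φ t = phiFn p t) ∧
  (∀ t : ℝ, 0 < t → t ≤ ε → φ t = -(t ^ (-q))) ∧
  (∀ t ∈ Set.Ioo (0:ℝ) 1, -(t ^ (-q)) ≤ φ t)

/-- The energy `Φ_ε(K, ξ) = ∫_{S^{n-1}} φ_ε (h_K(u) - ⟨u, ξ⟩) dμ(u)`. -/
def PhiE {n : ℕ} (μ : Measure (Eu n)) (φ : ℝ → ℝ) (K : Set (Eu n)) (ξ : Eu n) : ℝ :=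
  ∫ u, φ (suppFn K u - ⟪u, ξ⟫) ∂μ


/-- The surface area measure `S_K(ω) = H^{n-1}({x ∈ ∂K : ν_K(x) ∩ ω ≠ ∅})`. -/
def surfMeas {n : ℕ} (K : Set (Eu n)) (ω : Set (Eu n)) : ℝ≥0∞ :=
  μH[(n:ℝ) - 1] {x ∈ frontier K | ∃ u ∈ ω, IsOuterNormal K x u}

/-- `K` is quasi-smooth: the set of unit vectors which are normals only at singular boundary
points has `H^{n-1}`-measure zero. -/
def QuasiSmooth {n : ℕ} (K : Set (Eu n)) : Prop :=
  μH[(n:ℝ) - 1] (sphere (0 : Eu n) 1 \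
    {u | ∃ x ∈ frontier K, (∃! w, IsOuterNormal K x w) ∧ IsOuterNormal K x u}) = 0

/-! ### Cones and Hausdorff measure -/

lemma hausdorffMeasure_image_null {X Y : Type*} [EMetricSpace X] [EMetricSpace Y]
    [MeasurableSpace X] [BorelSpace X] [MeasurableSpace Y] [BorelSpace Y]
    [SecondCountableTopology X] {d : ℝ} (hd : 0 ≤ d) {f : X → Y} {s : Set X}
    (hf : ∀ x ∈ s, ∃ C, ∃ t ∈ nhds x, LipschitzOnWith C f t) (hs : μH[d] s = 0) :
    μH[d] (f '' s) = 0 := by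
  choose! C t ht hft using hf
  obtain ⟨I, hIs, hI, hsI⟩ := TopologicalSpace.countable_cover_nhdsWithin
    (f := fun x => s ∩ t x) (s := s)
    (fun x hx => inter_mem self_mem_nhdsWithin (mem_nhdsWithin_of_mem_nhds (ht x hx)))
  have h1 : f '' s ⊆ ⋃ x ∈ I, f '' (s ∩ t x) := by
    rw [← image_iUnion₂]
    exact image_mono hsI
  refine measure_mono_null h1 ((measure_biUnion_null_iff hI).2 fun x hx => ?_)
  refine le_antisymm ?_ zero_le
  refine (((hft x (hIs hx)).mono inter_subset_right).hausdorffMeasure_image_le hd).trans ?_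
  rw [measure_mono_null inter_subset_left hs, mul_zero]

/-- The coordinate splitting `x ↦ (x i, (x j)_{j ≠ i})`. -/
def coordSplit {m : ℕ} (i : Fin (m + 1)) : Eu (m + 1) ≃ᵐ ℝ × (Fin m → ℝ) :=
  (MeasurableEquiv.toLp 2 (Fin (m + 1) → ℝ)).symm.trans
    (MeasurableEquiv.piFinSuccAbove (fun _ => ℝ) i)

lemma measurePreserving_coordSplit {m : ℕ} (i : Fin (m + 1)) :
    MeasurePreserving (coordSplit i) volume volume :=
  (EuclideanSpace.volume_preserving_symm_measurableEquiv_toLp _).trans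
    (volume_preserving_piFinSuccAbove (fun _ => ℝ) i)

/-- The point with `i`-th coordinate `a` and remaining coordinates `y`. -/
def slicePoint {m : ℕ} (i : Fin (m + 1)) (a : ℝ) (y : Fin m → ℝ) : Eu (m + 1) :=
  WithLp.toLp 2 (i.insertNth a y)

lemma slicePoint_apply_same {m : ℕ} (i : Fin (m + 1)) (a : ℝ) (y : Fin m → ℝ) :
    slicePoint i a y i = a := by simp [slicePoint]

lemma slicePoint_apply_succAbove {m : ℕ} (i : Fin (m + 1)) (a : ℝ) (y : Fin m → ℝ) (j : Fin m) :
    slicePoint i a y (i.succAbove j) = y j := by simp [slicePoint]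

lemma slicePoint_self {m : ℕ} (i : Fin (m + 1)) (x : Eu (m + 1)) :
    slicePoint i (x i) (fun j => x (i.succAbove j)) = x := by
  ext k
  rcases Fin.eq_self_or_eq_succAbove i k with rfl | ⟨j, rfl⟩
  · rw [slicePoint_apply_same]
  · rw [slicePoint_apply_succAbove]

lemma slicePoint_coordSplit {m : ℕ} (i : Fin (m + 1)) (x : Eu (m + 1)) :
    slicePoint i (coordSplit i x).1 (coordSplit i x).2 = x :=
  slicePoint_self i x

lemma coordSplit_slicePoint {m : ℕ} (i : Fin (m + 1)) (a : ℝ) (y : Fin m → ℝ) :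
    coordSplit i (slicePoint i a y) = (a, y) := by
  ext1
  · exact slicePoint_apply_same i a y
  · funext j
    exact slicePoint_apply_succAbove i a y j

lemma smul_slicePoint {m : ℕ} (i : Fin (m + 1)) (c a : ℝ) (y : Fin m → ℝ) :
    c • slicePoint i a y = slicePoint i (c * a) (c • y) := by
  ext k
  rcases Fin.eq_self_or_eq_succAbove i k with rfl | ⟨j, rfl⟩
  · simp [slicePoint_apply_same]
  · simp [slicePoint_apply_succAbove]

lemma slicePoint_rescale {m : ℕ} {i : Fin (m + 1)} (σ : ℝ) {x : Eu (m + 1)} (hi : x i ≠ 0) :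
    slicePoint i σ ((σ / x i) • fun j => x (i.succAbove j)) = (σ / x i) • x := by
  have h := smul_slicePoint i (σ / x i) (x i) (fun j => x (i.succAbove j))
  rw [slicePoint_self, div_mul_cancel₀ _ hi] at h
  exact h.symm

lemma contDiff_slicePoint {m : ℕ} (i : Fin (m + 1)) (a : ℝ) :
    ContDiff ℝ 1 (slicePoint i a) := by
  rw [contDiff_euclidean]
  intro k
  rcases Fin.eq_self_or_eq_succAbove i k with rfl | ⟨j, rfl⟩
  · simp only [slicePoint_apply_same]
    exact contDiff_const
  · simp only [slicePoint_apply_succAbove]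
    fun_prop

lemma slicePoint_ne_zero {m : ℕ} (i : Fin (m + 1)) {a : ℝ} (ha : a ≠ 0) (y : Fin m → ℝ) :
    slicePoint i a y ≠ 0 := by
  intro h
  apply ha
  rw [← slicePoint_apply_same i a y, h]
  rfl

open scoped Pointwise in
lemma volume_slice_null {m : ℕ} {N : Set (Eu (m + 1))} (hN : volume N = 0)
    (hcone : ∀ x ∈ N, ∀ c : ℝ, 0 < c → c • x ∈ N) (i : Fin (m + 1)) {σ : ℝ} (hσ : σ ≠ 0) :
    volume {y | slicePoint i σ y ∈ N} = 0 := by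
  have h1 : volume {z : ℝ × (Fin m → ℝ) | slicePoint i z.1 z.2 ∈ N} = 0 := by
    rw [← (measurePreserving_coordSplit i).measure_preimage_equiv]
    refine measure_mono_null ?_ hN
    intro x hx
    simpa only [mem_preimage, mem_ofPred_eq, slicePoint_coordSplit] using hx
  have h2 := Measure.measure_ae_null_of_prod_null h1
  have h3 := Measure.dense_of_ae (μ := (volume : Measure ℝ)) h2
  have ho : IsOpen {a : ℝ | 0 < a / σ} :=
    isOpen_lt continuous_const (continuous_id.div_const σ)
  obtain ⟨a, ha, ha'⟩ := h3.inter_open_nonempty _ ho ⟨σ, by simp [hσ]⟩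
  have ha0 : a ≠ 0 := by
    rintro rfl
    simp at ha
  have h4 : volume {y | slicePoint i a y ∈ N} = 0 := ha'
  have h5 : {y | slicePoint i σ y ∈ N} ⊆ (σ / a) • {y | slicePoint i a y ∈ N} := by
    intro y hy
    refine ⟨(a / σ) • y, ?_, ?_⟩
    · have := hcone _ hy (a / σ) ha
      rw [smul_slicePoint, div_mul_cancel₀ _ hσ] at this
      exact this
    · simp only [smul_smul]
      rw [show σ / a * (a / σ) = 1 by field_simp, one_smul]
  refine measure_mono_null h5 ?_
  rw [Measure.addHaar_smul, h4, mul_zero]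

lemma hausdorffMeasure_pi_null {m : ℕ} {s : Set (Fin m → ℝ)} (hs : volume s = 0) :
    μH[((m + 1 : ℕ) : ℝ) - 1] s = 0 := by
  rw [show ((m + 1 : ℕ) : ℝ) - 1 = (Fintype.card (Fin m) : ℝ) by simp, hausdorffMeasure_pi_real]
  exact hs

lemma dim_nonneg (m : ℕ) : (0 : ℝ) ≤ ((m + 1 : ℕ) : ℝ) - 1 := by
  push_cast
  linarith [(Nat.cast_nonneg m : (0 : ℝ) ≤ m)]

/-- A Lebesgue-null cone meets a Lipschitz star-shaped hypersurface in a set of vanishing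
`(n-1)`-dimensional Hausdorff measure. -/
lemma hausdorffMeasure_cone_inter_null {m : ℕ} {N : Set (Eu (m + 1))} (hN : volume N = 0)
    (hcone : ∀ x ∈ N, ∀ c : ℝ, 0 < c → c • x ∈ N) {g : Eu (m + 1) → ℝ} {C : ℝ≥0}
    (hg : LipschitzWith C g) (hhom : ∀ (c : ℝ) x, 0 < c → g (c • x) = c * g x) :
    μH[((m + 1 : ℕ) : ℝ) - 1] (N ∩ {x | g x = 1}) = 0 := by
  have g0 : g 0 = 0 := by
    have := hhom 2 0 (by norm_num)
    rw [smul_zero] at this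
    linarith
  let Y : Fin (m + 1) → ℝ → Set (Fin m → ℝ) := fun i σ =>
    {y | slicePoint i σ y ∈ N} ∩ {y | 0 < g (slicePoint i σ y)}
  let F : Fin (m + 1) → ℝ → (Fin m → ℝ) → Eu (m + 1) := fun i σ y =>
    (g (slicePoint i σ y))⁻¹ • slicePoint i σ y
  have hF : ∀ i σ, σ ≠ 0 → μH[((m + 1 : ℕ) : ℝ) - 1] (F i σ '' Y i σ) = 0 := by
    intro i σ hσ
    apply hausdorffMeasure_image_null (dim_nonneg m)
    · rintro y ⟨-, hy⟩
      have hy : 0 < g (slicePoint i σ y) := hy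
      let G : (Fin m → ℝ) → ℝ × Eu (m + 1) := fun y => (g (slicePoint i σ y), slicePoint i σ y)
      let H : ℝ × Eu (m + 1) → Eu (m + 1) := fun z => z.1⁻¹ • z.2
      have h1 : ContDiffAt ℝ 1 H (G y) :=
        (contDiffAt_fst.inv hy.ne').smul contDiffAt_snd
      obtain ⟨C₁, t, ht, hC₁⟩ := h1.exists_lipschitzOnWith
      obtain ⟨C₂, s, hs, hC₂⟩ :=
        ((contDiff_slicePoint i σ).contDiffAt (x := y)).exists_lipschitzOnWith
      have h2 : LipschitzOnWith (max (C * C₂) C₂) G s :=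
        (hg.comp_lipschitzOnWith hC₂).prodMk hC₂
      have hcont : Continuous G :=
        (hg.continuous.comp (contDiff_slicePoint i σ).continuous).prodMk
          (contDiff_slicePoint i σ).continuous
      have h3 : LipschitzOnWith (C₁ * max (C * C₂) C₂) (H ∘ G) (s ∩ G ⁻¹' t) :=
        hC₁.comp (h2.mono inter_subset_left) (fun z hz => hz.2)
      exact ⟨_, s ∩ G ⁻¹' t, inter_mem hs (hcont.continuousAt.preimage_mem_nhds ht), h3⟩
    · exact measure_mono_null inter_subset_left
        (hausdorffMeasure_pi_null (volume_slice_null hN hcone i hσ))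
  have hsub : N ∩ {x | g x = 1} ⊆ ⋃ i, (F i 1 '' Y i 1 ∪ F i (-1) '' Y i (-1)) := by
    rintro x ⟨hxN, hx⟩
    have hx : g x = 1 := hx
    have hx0 : x ≠ 0 := by
      rintro rfl
      rw [g0] at hx
      norm_num at hx
    obtain ⟨i, hi⟩ : ∃ i, x i ≠ 0 := by
      by_contra! h
      exact hx0 (by ext i; simpa using h i)
    have key : ∀ σ : ℝ, 0 < σ / x i → x ∈ F i σ '' Y i σ := by
      intro σ hσ
      have hσ0 : σ ≠ 0 := by
        rintro rfl
        simp at hσ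
      have h1 := slicePoint_rescale σ hi
      refine ⟨(σ / x i) • fun j => x (i.succAbove j), ⟨?_, ?_⟩, ?_⟩
      · simp only [mem_ofPred_eq, h1]
        exact hcone x hxN _ hσ
      · simp only [mem_ofPred_eq, h1]
        rw [hhom _ _ hσ, hx, mul_one]
        exact hσ
      · simp only [F, h1]
        rw [hhom _ _ hσ, hx, mul_one, smul_smul, inv_mul_cancel₀ hσ.ne', one_smul]
    refine mem_iUnion.2 ⟨i, ?_⟩
    rcases lt_or_gt_of_ne hi with h | h
    · exact Or.inr (key _ (div_pos_of_neg_of_neg (by norm_num) h))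
    · exact Or.inl (key _ (by positivity))
  refine measure_mono_null hsub (measure_iUnion_null fun i => measure_union_null ?_ ?_)
  · exact hF i 1 (by norm_num)
  · exact hF i (-1) (by norm_num)

lemma hausdorffMeasure_sphere_lt_top (m : ℕ) :
    μH[((m + 1 : ℕ) : ℝ) - 1] (sphere (0 : Eu (m + 1)) 1) < ⊤ := by
  let F : Fin (m + 1) → ℝ → (Fin m → ℝ) → Eu (m + 1) := fun i σ y =>
    (‖slicePoint i σ y‖)⁻¹ • slicePoint i σ y
  have hF : ∀ i σ, σ ≠ 0 → μH[((m + 1 : ℕ) : ℝ) - 1] (F i σ '' closedBall 0 1) < ⊤ := by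
    intro i σ hσ
    have h1 : ContDiff ℝ 1 (F i σ) := by
      refine ContDiff.smul (ContDiff.inv ((contDiff_slicePoint i σ).norm ℝ ?_) ?_)
        (contDiff_slicePoint i σ)
      · exact fun y => slicePoint_ne_zero i hσ y
      · exact fun y => norm_ne_zero_iff.2 (slicePoint_ne_zero i hσ y)
    obtain ⟨C, hC⟩ := h1.contDiffOn.exists_lipschitzOnWith one_ne_zero
      (convex_closedBall (0 : Fin m → ℝ) 1) (isCompact_closedBall _ _)
    refine (hC.hausdorffMeasure_image_le (dim_nonneg m)).trans_lt ?_
    refine ENNReal.mul_lt_top (ENNReal.rpow_lt_top_of_nonneg (dim_nonneg m) ENNReal.coe_ne_top) ?_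
    rw [show ((m + 1 : ℕ) : ℝ) - 1 = (Fintype.card (Fin m) : ℝ) by simp, hausdorffMeasure_pi_real]
    exact (isCompact_closedBall _ _).measure_lt_top
  have hsub : sphere (0 : Eu (m + 1)) 1 ⊆
      ⋃ i ∈ (Finset.univ : Finset (Fin (m + 1))),
        (F i 1 '' closedBall 0 1 ∪ F i (-1) '' closedBall 0 1) := by
    intro x hx
    have hx : ‖x‖ = 1 := by simpa using hx
    obtain ⟨i, -, himax⟩ := Finset.exists_max_image Finset.univ (fun i => |x i|) ⟨0, by simp⟩
    have hi : x i ≠ 0 := by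
      intro h
      have : x = 0 := by
        ext k
        have := himax k (by simp)
        rw [h, abs_zero] at this
        simpa using this
      rw [this, norm_zero] at hx
      norm_num at hx
    have key : ∀ σ : ℝ, |σ| = 1 → 0 < σ / x i → x ∈ F i σ '' closedBall 0 1 := by
      intro σ hσ1 hσ
      have h1 := slicePoint_rescale σ hi
      refine ⟨(σ / x i) • fun j => x (i.succAbove j), ?_, ?_⟩
      · rw [mem_closedBall, dist_zero_right, pi_norm_le_iff_of_nonneg zero_le_one]
        intro j
        rw [Pi.smul_apply, smul_eq_mul, Real.norm_eq_abs, abs_mul, abs_div, hσ1,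
          div_mul_eq_mul_div, one_mul, div_le_one (abs_pos.2 hi)]
        exact himax _ (by simp)
      · simp only [F, h1]
        rw [norm_smul, hx, mul_one, Real.norm_of_nonneg hσ.le, smul_smul, inv_mul_cancel₀ hσ.ne',
          one_smul]
    refine mem_iUnion₂.2 ⟨i, by simp, ?_⟩
    rcases lt_or_gt_of_ne hi with h | h
    · exact Or.inr (key _ (by simp) (div_pos_of_neg_of_neg (by norm_num) h))
    · exact Or.inl (key _ (by simp) (by positivity))
  refine (measure_mono hsub).trans_lt (measure_biUnion_lt_top (Finset.finite_toSet _) ?_)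
  intro i _
  exact measure_union_lt_top (hF i 1 (by norm_num)) (hF i (-1) (by norm_num))

/-- The cone over a set of vanishing `(n-1)`-dimensional Hausdorff measure is Lebesgue-null. -/
lemma volume_cone_null {m : ℕ} {X : Set (Eu (m + 1))} (hX : (0 : Eu (m + 1)) ∉ X)
    (hXnull : μH[((m + 1 : ℕ) : ℝ) - 1] X = 0) :
    volume ((fun z : ℝ × Eu (m + 1) => z.1 • z.2) '' (univ ×ˢ X)) = 0 := by
  let Q : Fin (m + 1) → Eu (m + 1) → (Fin m → ℝ) := fun i x j => x (i.succAbove j) / x i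
  have hQ : ∀ i, volume (Q i '' (X ∩ {x | x i ≠ 0})) = 0 := by
    intro i
    have h1 : μH[((m + 1 : ℕ) : ℝ) - 1] (Q i '' (X ∩ {x | x i ≠ 0})) = 0 := by
      apply hausdorffMeasure_image_null (dim_nonneg m)
      · rintro x ⟨-, hx⟩
        apply ContDiffAt.exists_lipschitzOnWith (𝕂 := ℝ)
        rw [contDiffAt_pi]
        intro j
        exact ContDiffAt.div (by fun_prop) (by fun_prop) hx
      · exact measure_mono_null inter_subset_left hXnull
    rwa [show ((m + 1 : ℕ) : ℝ) - 1 = (Fintype.card (Fin m) : ℝ) by simp,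
      hausdorffMeasure_pi_real] at h1
  have hsub : (fun z : ℝ × Eu (m + 1) => z.1 • z.2) '' (univ ×ˢ X) ⊆
      ⋃ i, coordSplit i ⁻¹' ((fun w : ℝ × (Fin m → ℝ) => (w.1, w.1 • w.2)) ''
        (univ ×ˢ (Q i '' (X ∩ {x | x i ≠ 0})))) := by
    rintro _ ⟨⟨c, x⟩, ⟨-, hx⟩, rfl⟩
    have hx : x ∈ X := hx
    obtain ⟨i, hi⟩ : ∃ i, x i ≠ 0 := by
      by_contra! h
      have : x = 0 := by ext i; simpa using h i
      exact hX (this ▸ hx)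
    refine mem_iUnion.2 ⟨i, (c * x i, Q i x), ⟨mem_univ _, x, ⟨hx, hi⟩, rfl⟩, ?_⟩
    simp only
    conv_rhs => rw [← slicePoint_self i x]
    rw [smul_slicePoint, coordSplit_slicePoint]
    congr 1
    funext j
    simp only [Q, Pi.smul_apply, smul_eq_mul]
    field_simp
  refine measure_mono_null hsub (measure_iUnion_null fun i => ?_)
  rw [(measurePreserving_coordSplit i).measure_preimage_equiv]
  have : (volume : Measure (ℝ × (Fin m → ℝ))).IsAddHaarMeasure := by
    rw [Measure.volume_eq_prod]
    infer_instance
  apply addHaar_image_eq_zero_of_differentiableOn_of_addHaar_eq_zero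
  · fun_prop
  · rw [Measure.volume_eq_prod, Measure.prod_prod, hQ i, mul_zero]

/-! ### Support functions -/

section SupportFunction

variable {n : ℕ} {K : Set (Eu n)}

lemma inner_le_suppFn (hK : IsCompact K) {x : Eu n} (hx : x ∈ K) (u : Eu n) :
    ⟪x, u⟫ ≤ suppFn K u :=
  le_csSup (hK.image (by fun_prop)).bddAbove ⟨x, hx, rfl⟩

lemma suppFn_le (hne : K.Nonempty) {u : Eu n} {c : ℝ} (h : ∀ x ∈ K, ⟪x, u⟫ ≤ c) :
    suppFn K u ≤ c := by
  apply csSup_le (hne.image _)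
  rintro _ ⟨x, hx, rfl⟩
  exact h x hx

lemma exists_inner_eq_suppFn (hK : IsCompact K) (hne : K.Nonempty) (u : Eu n) :
    ∃ x ∈ K, ⟪x, u⟫ = suppFn K u := by
  obtain ⟨x, hx, hmax⟩ := hK.exists_isMaxOn hne
    (f := fun x => ⟪x, u⟫) (by fun_prop)
  exact ⟨x, hx, le_antisymm (inner_le_suppFn hK hx u) (suppFn_le hne hmax)⟩

lemma lipschitzWith_suppFn (hK : IsCompact K) (hne : K.Nonempty) :
    ∃ C, LipschitzWith C (suppFn K) := by
  obtain ⟨R, hR⟩ := hK.isBounded.exists_norm_le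
  refine ⟨Real.toNNReal R, LipschitzWith.of_le_add_mul _ fun u v => ?_⟩
  have hR0 : 0 ≤ R := (norm_nonneg _).trans (hR _ hne.some_mem)
  rw [Real.coe_toNNReal _ hR0]
  refine suppFn_le hne fun x hx => ?_
  have h1 : ⟪x, u⟫ = ⟪x, v⟫ + ⟪x, u - v⟫ := by rw [inner_sub_right]; ring
  have h2 : ⟪x, u - v⟫ ≤ ‖x‖ * ‖u - v‖ := real_inner_le_norm _ _
  have h3 : ‖x‖ * ‖u - v‖ ≤ R * ‖u - v‖ :=
    mul_le_mul_of_nonneg_right (hR x hx) (norm_nonneg _)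
  rw [h1, dist_eq_norm]
  linarith [inner_le_suppFn hK hx v]

lemma continuous_suppFn (hK : IsCompact K) (hne : K.Nonempty) : Continuous (suppFn K) :=
  (lipschitzWith_suppFn hK hne).choose_spec.continuous

lemma suppFn_smul_right (hK : IsCompact K) (hne : K.Nonempty) {c : ℝ} (hc : 0 < c) (u : Eu n) :
    suppFn K (c • u) = c * suppFn K u := by
  apply le_antisymm
  · refine suppFn_le hne fun x hx => ?_
    rw [real_inner_smul_right]
    exact mul_le_mul_of_nonneg_left (inner_le_suppFn hK hx u) hc.le
  · obtain ⟨x, hx, h⟩ := exists_inner_eq_suppFn hK hne u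
    rw [← h, ← real_inner_smul_right]
    exact inner_le_suppFn hK hx _

lemma isOuterNormal_iff (hK : IsCompact K) {x u : Eu n} (hx : x ∈ K) :
    IsOuterNormal K x u ↔ ‖u‖ = 1 ∧ ⟪x, u⟫ = suppFn K u := by
  constructor
  · rintro ⟨hu, h⟩
    exact ⟨hu, le_antisymm (inner_le_suppFn hK hx u) (suppFn_le ⟨x, hx⟩ h)⟩
  · rintro ⟨hu, h⟩
    exact ⟨hu, fun y hy => h ▸ inner_le_suppFn hK hy u⟩

lemma inner_lt_suppFn (hK : IsCompact K) {x : Eu n} (hx : x ∈ interior K) {u : Eu n}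
    (hu : u ≠ 0) : ⟪x, u⟫ < suppFn K u := by
  have hnear : ∀ᶠ s : ℝ in nhds 0, x + s • u ∈ K := by
    have hc : ContinuousAt (fun s : ℝ => x + s • u) 0 := by fun_prop
    have h0 : K ∈ nhds ((fun s : ℝ => x + s • u) 0) := by
      simpa using mem_interior_iff_mem_nhds.1 hx
    exact hc h0
  obtain ⟨s, hs0, hs⟩ := ((hnear.filter_mono nhdsWithin_le_nhds).and
    (self_mem_nhdsWithin (a := (0 : ℝ)) (s := Ioi 0))).exists.imp fun s h => And.symm h
  have h1 := inner_le_suppFn hK hs u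
  rw [inner_add_left, real_inner_smul_left, real_inner_self_eq_norm_sq] at h1
  have : 0 < s * ‖u‖ ^ 2 := mul_pos hs0 (by positivity)
  linarith

lemma IsOuterNormal.mem_frontier (hK : IsCompact K) {x u : Eu n} (hx : x ∈ K)
    (h : IsOuterNormal K x u) : x ∈ frontier K := by
  rw [hK.isClosed.frontier_eq]
  refine ⟨hx, fun hi => ?_⟩
  have hu : u ≠ 0 := by
    rintro rfl
    simpa using h.1
  exact (inner_lt_suppFn hK hi hu).ne ((isOuterNormal_iff hK hx).1 h).2

lemma surfMeas_eq (hK : IsCompact K) {ω : Set (Eu n)} (hω : ω ⊆ sphere 0 1) :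
    surfMeas K ω = μH[(n : ℝ) - 1] {x ∈ K | ∃ u ∈ ω, ⟪x, u⟫ = suppFn K u} := by
  unfold surfMeas
  congr 1
  ext x
  constructor
  · rintro ⟨hx, u, hu, h⟩
    have hxK := hK.isClosed.frontier_subset hx
    exact ⟨hxK, u, hu, ((isOuterNormal_iff hK hxK).1 h).2⟩
  · rintro ⟨hx, u, hu, h⟩
    have hN := (isOuterNormal_iff hK hx).2 ⟨by simpa using hω hu, h⟩
    exact ⟨hN.mem_frontier hK hx, u, hu, hN⟩

end SupportFunction

/-! ### Volume lost by pushing in facets -/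

/-- The body obtained from `K` by pushing in by `t` the supporting halfspaces with normals
in `ω`. -/
def shrink {n : ℕ} (K ω : Set (Eu n)) (t : ℝ) : Set (Eu n) :=
  {x ∈ K | ∀ u ∈ ω, ⟪x, u⟫ ≤ suppFn K u - t}

section Shrink

variable {n : ℕ} {K ω : Set (Eu n)}

lemma shrink_subset (t : ℝ) : shrink K ω t ⊆ K := fun _ h => h.1

lemma shrink_eq (t : ℝ) : shrink K ω t = K ∩ ⋂ u ∈ ω, {x | ⟪x, u⟫ ≤ suppFn K u - t} := by
  ext x
  simp [shrink]

lemma isCompact_shrink (hK : IsCompact K) (t : ℝ) : IsCompact (shrink K ω t) := by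
  rw [shrink_eq]
  refine hK.inter_right (isClosed_biInter fun u _ => isClosed_le ?_ continuous_const)
  fun_prop

lemma convex_shrink (hK : Convex ℝ K) (t : ℝ) : Convex ℝ (shrink K ω t) := by
  rw [shrink_eq]
  refine hK.inter (convex_iInter₂ fun u _ => convex_halfSpace_le ⟨?_, ?_⟩ _)
  · intro x y
    exact inner_add_left _ _ _
  · intro c x
    exact real_inner_smul_left _ _ _

lemma le_suppFn_of_closedBall_subset (hK : IsCompact K) {r : ℝ} (hr : 0 ≤ r)
    (hball : closedBall 0 r ⊆ K) {u : Eu n} (hu : ‖u‖ = 1) : r ≤ suppFn K u := by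
  have h1 : r • u ∈ K := hball (by simp [norm_smul, hu, abs_of_nonneg hr])
  have h2 := inner_le_suppFn hK h1 u
  rw [real_inner_smul_left, real_inner_self_eq_norm_sq, hu] at h2
  linarith

lemma closedBall_subset_shrink (hK : IsCompact K) (hω : ω ⊆ sphere 0 1) {r t : ℝ} (hr : 0 ≤ r)
    (hball : closedBall 0 r ⊆ K) (ht : 0 ≤ t) : closedBall 0 (r - t) ⊆ shrink K ω t := by
  intro x hx
  refine ⟨hball (closedBall_subset_closedBall (by linarith) hx), fun u hu => ?_⟩
  have hu1 : ‖u‖ = 1 := by simpa using hω hu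
  have h1 := real_inner_le_norm x u
  rw [hu1, mul_one] at h1
  have h2 : ‖x‖ ≤ r - t := by simpa using hx
  linarith [le_suppFn_of_closedBall_subset hK hr hball hu1]

end Shrink

open scoped Pointwise in
/-- A part of a thin shell `L \ (1 - s) L` has volume at most a multiple of `s` times the volume
of the cone segment it spans. -/
lemma volume_shell_le {n : ℕ} {L E V : Set (Eu n)} (hL : Convex ℝ L) (h0 : (0 : Eu n) ∈ L)
    {s : ℝ} (hs0 : 0 < s) (hs : s ≤ 1 / 2) (hE : MeasurableSet E) (hEL : E ⊆ L)
    (hdisj : ∀ x ∈ L, (1 - s) • x ∉ E)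
    (hV : ∀ c ∈ Icc (1 / 2 : ℝ) 1, ∀ x ∈ E, c • x ∈ V) :
    volume E ≤ ENNReal.ofReal (2 * s * 2 ^ n) * volume V := by
  set a : ℝ := 1 - s with ha
  have ha0 : 0 < a := by linarith
  have ha1 : a ≤ 1 := by linarith
  set N : ℕ := ⌊1 / (2 * s)⌋₊ with hN
  have hpow : ∀ j ∈ Finset.range (N + 1), (1 / 2 : ℝ) ≤ a ^ j := by
    intro j hj
    have hjN : j ≤ N := Nat.lt_succ_iff.1 (Finset.mem_range.1 hj)
    have h1 : (j : ℝ) ≤ 1 / (2 * s) :=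
      (Nat.cast_le.2 hjN).trans (Nat.floor_le (by positivity))
    have h2 : (j : ℝ) * (2 * s) ≤ 1 := (le_div_iff₀ (by positivity)).1 h1
    have h3 := one_add_mul_le_pow (a := -s) (by linarith) j
    have h4 : 1 + -s = a := by rw [ha]; ring
    rw [h4] at h3
    nlinarith
  have hdis : (Finset.range (N + 1) : Set ℕ).PairwiseDisjoint (fun j => a ^ j • E) := by
    have key : ∀ i j, i < j → Disjoint (a ^ i • E) (a ^ j • E) := by
      intro i j hij
      rw [Set.disjoint_left]
      rintro _ ⟨e, he, rfl⟩ ⟨e', he', h⟩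
      obtain ⟨k, rfl⟩ := Nat.exists_eq_add_of_lt hij
      have h' : a ^ i • (a • (a ^ k • e')) = a ^ i • e := by
        rw [smul_smul, smul_smul, show a ^ i * a * a ^ k = a ^ (i + k + 1) by ring]
        exact h
      have h1 : a • (a ^ k • e') = e := smul_right_injective _ (pow_pos ha0 i).ne' h'
      have h2 : a ^ k • e' ∈ L :=
        hL.smul_mem_of_zero_mem h0 (hEL he') ⟨by positivity, pow_le_one₀ ha0.le ha1⟩
      exact hdisj _ h2 (h1 ▸ he)
    intro i _ j _ hij
    rcases lt_or_gt_of_ne hij with h | h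
    · exact key i j h
    · exact (key j i h).symm
  have hsum : ∑ j ∈ Finset.range (N + 1), volume (a ^ j • E) ≤ volume V := by
    rw [← measure_biUnion_finset hdis fun j _ => hE.const_smul₀ _]
    refine measure_mono (iUnion₂_subset fun j hj => ?_)
    rintro _ ⟨e, he, rfl⟩
    exact hV _ ⟨hpow j hj, pow_le_one₀ ha0.le ha1⟩ e he
  have hterm : ∀ j ∈ Finset.range (N + 1),
      ENNReal.ofReal ((1 / 2) ^ n) * volume E ≤ volume (a ^ j • E) := by
    intro j hj
    rw [Measure.addHaar_smul, finrank_euclideanSpace_fin]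
    gcongr
    rw [abs_of_nonneg (by positivity)]
    exact pow_le_pow_left₀ (by norm_num) (hpow j hj) n
  have h1 : ((N + 1 : ℕ) : ℝ≥0∞) * (ENNReal.ofReal ((1 / 2) ^ n) * volume E) ≤ volume V := by
    refine le_trans ?_ hsum
    have := Finset.card_nsmul_le_sum _ _ _ hterm
    rwa [Finset.card_range, nsmul_eq_mul] at this
  have hN1 : 1 ≤ 2 * s * ((N + 1 : ℕ) : ℝ) := by
    have h2 := (Nat.lt_floor_add_one (1 / (2 * s))).le
    rw [div_le_iff₀ (by positivity)] at h2
    push_cast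
    linarith
  have h3 : (1 : ℝ≥0∞) ≤ ENNReal.ofReal (2 * s * 2 ^ n) *
      (((N + 1 : ℕ) : ℝ≥0∞) * ENNReal.ofReal ((1 / 2) ^ n)) := by
    rw [← ENNReal.ofReal_natCast, ← ENNReal.ofReal_mul (by positivity),
      ← ENNReal.ofReal_mul (by positivity), ← ENNReal.ofReal_one]
    apply ENNReal.ofReal_le_ofReal
    have : 2 * s * 2 ^ n * (((N + 1 : ℕ) : ℝ) * (1 / 2) ^ n) =
        2 * s * ((N + 1 : ℕ) : ℝ) * (2 * (1 / 2)) ^ n := by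
      rw [mul_pow]; ring
    rw [this]
    simpa using hN1
  calc volume E = 1 * volume E := (one_mul _).symm
    _ ≤ ENNReal.ofReal (2 * s * 2 ^ n) *
      (((N + 1 : ℕ) : ℝ≥0∞) * ENNReal.ofReal ((1 / 2) ^ n)) * volume E := by gcongr
    _ = ENNReal.ofReal (2 * s * 2 ^ n) *
      (((N + 1 : ℕ) : ℝ≥0∞) * (ENNReal.ofReal ((1 / 2) ^ n) * volume E)) := by ring
    _ ≤ _ := by gcongr

lemma volume_diff_shrink_le {m : ℕ} {L ω : Set (Eu (m + 1))} (hconv : Convex ℝ L)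
    (hL : IsCompact L) {r : ℝ} (hr : 0 < r) (hball : closedBall 0 r ⊆ L) (hω : IsClosed ω)
    (hωs : ω ⊆ sphere 0 1) (hnull : surfMeas L ω = 0) {δ : ℝ} (hδ : 0 < δ) :
    ∃ t₀ > 0, ∀ t, 0 < t → t < t₀ →
      volume (L \ shrink L ω t) ≤ ENNReal.ofReal (δ * t) := by
  have h0L : (0 : Eu (m + 1)) ∈ L := hball (by simp [hr.le])
  have hωc : IsCompact ω := (isCompact_sphere _ _).of_isClosed_subset hω hωs
  have hcont := continuous_suppFn hL ⟨0, h0L⟩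
  set X : Set (Eu (m + 1)) := {x ∈ L | ∃ u ∈ ω, ⟪x, u⟫ = suppFn L u} with hX
  have hXc : IsCompact X := by
    have h1 : IsCompact ((L ×ˢ ω) ∩ {z : Eu (m + 1) × Eu (m + 1) | ⟪z.1, z.2⟫ = suppFn L z.2}) :=
      (hL.prod hωc).inter_right (isClosed_eq (by fun_prop) (hcont.comp continuous_snd))
    convert h1.image continuous_fst
    ext x
    constructor
    · rintro ⟨hx, u, hu, h⟩
      exact ⟨(x, u), ⟨⟨hx, hu⟩, h⟩, rfl⟩
    · rintro ⟨⟨x, u⟩, ⟨⟨hx, hu⟩, h⟩, rfl⟩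
      exact ⟨hx, u, hu, h⟩
  have hX0 : (0 : Eu (m + 1)) ∉ X := by
    rintro ⟨-, u, hu, h⟩
    have := le_suppFn_of_closedBall_subset hL hr.le hball (u := u) (by simpa using hωs hu)
    rw [inner_zero_left] at h
    linarith
  have hXnull : μH[((m + 1 : ℕ) : ℝ) - 1] X = 0 := by
    rw [← hnull, surfMeas_eq hL hωs]
  set C : Set (Eu (m + 1)) :=
    (fun z : ℝ × Eu (m + 1) => z.1 • z.2) '' (Icc (1 / 2 : ℝ) 1 ×ˢ X) with hC
  have hCc : IsCompact C := (isCompact_Icc.prod hXc).image (by fun_prop)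
  have hCnull : volume C = 0 :=
    measure_mono_null (image_mono (prod_mono_left (subset_univ _))) (volume_cone_null hX0 hXnull)
  have hlim := tendsto_measure_cthickening_of_isCompact (μ := volume) hCc
  rw [hCnull] at hlim
  have hb : (0 : ℝ≥0∞) < ENNReal.ofReal (δ * r / (2 * 2 ^ (m + 1))) :=
    ENNReal.ofReal_pos.2 (by positivity)
  obtain ⟨η, hη0, hη⟩ := (((hlim.eventually (gt_mem_nhds hb)).filter_mono
    nhdsWithin_le_nhds).and (self_mem_nhdsWithin (a := (0 : ℝ)) (s := Ioi 0))).exists.imp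
      fun s h => And.symm h
  have hη0 : 0 < η := hη0
  obtain ⟨t₁, ht₁, hnear⟩ : ∃ t₁ > 0, ∀ x ∈ L, ∀ u ∈ ω, suppFn L u - ⟪x, u⟫ < t₁ →
      x ∈ thickening η X := by
    have hFc : IsCompact ((L \ thickening η X) ×ˢ ω) := (hL.diff isOpen_thickening).prod hωc
    rcases ((L \ thickening η X) ×ˢ ω).eq_empty_or_nonempty with hemp | hne
    · refine ⟨1, one_pos, fun x hx u hu _ => ?_⟩
      by_contra hxn
      have : (x, u) ∈ (L \ thickening η X) ×ˢ ω := ⟨⟨hx, hxn⟩, hu⟩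
      rw [hemp] at this
      exact this
    · obtain ⟨⟨x₀, u₀⟩, ⟨⟨hx₀, hx₀n⟩, hu₀⟩, hmin⟩ := hFc.exists_isMinOn hne
        (f := fun z : Eu (m + 1) × Eu (m + 1) => suppFn L z.2 - ⟪z.1, z.2⟫)
        ((hcont.comp continuous_snd).sub (by fun_prop)).continuousOn
      refine ⟨suppFn L u₀ - ⟪x₀, u₀⟫, ?_, fun x hx u hu hlt => ?_⟩
      · refine sub_pos.2 (lt_of_le_of_ne (inner_le_suppFn hL hx₀ _) fun h => ?_)
        exact hx₀n (self_subset_thickening hη0 _ ⟨hx₀, u₀, hu₀, h⟩)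
      · by_contra hxn
        exact absurd (hmin (a := (x, u)) ⟨⟨hx, hxn⟩, hu⟩) (not_le.2 hlt)
  refine ⟨min t₁ (r / 2), by positivity, fun t ht htlt => ?_⟩
  have htt₁ : t < t₁ := htlt.trans_le (min_le_left _ _)
  have htr : t < r / 2 := htlt.trans_le (min_le_right _ _)
  have hmeas : MeasurableSet (L \ shrink L ω t) :=
    hL.isClosed.measurableSet.diff (isCompact_shrink hL t).isClosed.measurableSet
  have hshell := volume_shell_le (V := cthickening η C) hconv h0L (s := t / r) (by positivity)
    (by rw [div_le_iff₀ hr]; linarith) hmeas sdiff_subset ?_ ?_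
  · refine hshell.trans ?_
    calc ENNReal.ofReal (2 * (t / r) * 2 ^ (m + 1)) * volume (cthickening η C)
        ≤ ENNReal.ofReal (2 * (t / r) * 2 ^ (m + 1)) *
          ENNReal.ofReal (δ * r / (2 * 2 ^ (m + 1))) := by gcongr
      _ = ENNReal.ofReal (δ * t) := by
        rw [← ENNReal.ofReal_mul (by positivity)]
        congr 1
        field_simp
  · rintro x hx ⟨-, hn⟩
    refine hn ⟨?_, fun u hu => ?_⟩
    · exact hconv.smul_mem_of_zero_mem h0L hx
        ⟨by rw [sub_nonneg, div_le_one hr]; linarith, by linarith [div_pos ht hr]⟩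
    · have h1 := le_suppFn_of_closedBall_subset hL hr.le hball (u := u) (by simpa using hωs hu)
      have h2 := inner_le_suppFn hL hx u
      have hs1 : 0 ≤ 1 - t / r := by rw [sub_nonneg, div_le_one hr]; linarith
      have h3 : t ≤ t / r * suppFn L u := by
        calc t = t / r * r := by field_simp
          _ ≤ _ := by gcongr
      rw [real_inner_smul_left]
      nlinarith [mul_le_mul_of_nonneg_left h2 hs1]
  · rintro c hc x ⟨hxL, hxn⟩
    obtain ⟨u, hu, hlt⟩ : ∃ u ∈ ω, suppFn L u - t < ⟪x, u⟫ := by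
      by_contra! h
      exact hxn ⟨hxL, h⟩
    have hx := hnear x hxL u hu (by linarith)
    obtain ⟨y, hy, hxy⟩ := mem_thickening_iff.1 hx
    refine mem_cthickening_of_dist_le _ (c • y) _ _ ⟨(c, y), ⟨hc, hy⟩, rfl⟩ ?_
    rw [dist_smul₀, Real.norm_of_nonneg (by linarith [hc.1])]
    calc c * dist x y ≤ 1 * dist x y := by gcongr; exact hc.2
      _ ≤ η := by rw [one_mul]; exact hxy.le

/-! ### Pointwise estimates for the energy density -/

section Density

variable {p ε q : ℝ} {φ : ℝ → ℝ}

/-- Dilating the argument of `φ` by a factor `l ∈ [1, 2]` increases `φ` by at most a multiple of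
`l - 1`, the multiple being affine in the value of `φ`. -/
lemma exists_dilation_bound (hmono : StrictMonoOn φ (Ioi 0)) (hconc : ConcaveOn ℝ (Ioi 0) φ)
    (hε : 0 < ε) (hq : 0 ≤ q) (hsing : ∀ t : ℝ, 0 < t → t ≤ ε → φ t = -(t ^ (-q)))
    {R : ℝ} (hR : 0 < R) :
    ∃ A B : ℝ, 0 ≤ B ∧ ∀ l a : ℝ, 1 ≤ l → l ≤ 2 → 0 < a → l * a ≤ R →
      φ (l * a) - φ a ≤ (l - 1) * (A - B * φ (l * a)) := by
  set B : ℝ := 2 * (4 : ℝ) ^ q with hB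
  have hB0 : 0 ≤ B := by positivity
  refine ⟨2 * |φ R| + 2 * |φ (ε / 4)| + B * |φ R|, B, hB0, fun l a hl1 hl2 ha hla => ?_⟩
  have hla0 : 0 < l * a := by positivity
  have hle : φ (l * a) ≤ φ R := hmono.monotoneOn hla0 hR hla
  have hsec : φ (l * a) - φ a ≤ (l - 1) * (2 * (φ a - φ (a / 2))) := by
    rcases eq_or_lt_of_le hl1 with rfl | hl
    · simp
    · have h1 := hconc.slope_anti_adjacent (x := a / 2) (y := a) (z := l * a)
        (by simpa using ha) hla0 (by linarith) (by nlinarith)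
      have h2 : 0 < l * a - a := by nlinarith
      rw [div_le_div_iff₀ h2 (by linarith)] at h1
      have h3 : (φ (l * a) - φ a) * (a / 2) ≤ (l - 1) * (2 * (φ a - φ (a / 2))) * (a / 2) := by
        nlinarith
      exact le_of_mul_le_mul_right h3 (by positivity)
  refine hsec.trans (mul_le_mul_of_nonneg_left ?_ (by linarith))
  have hale : φ a ≤ φ R :=
    (hmono.monotoneOn ha hla0 (by nlinarith)).trans hle
  have hb1 : B * φ (l * a) ≤ B * |φ R| :=
    mul_le_mul_of_nonneg_left (hle.trans (le_abs_self _)) hB0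
  have hb2 : φ R ≤ |φ R| := le_abs_self _
  have hb3 : 0 ≤ |φ (ε / 4)| := abs_nonneg _
  have hb4 : 0 ≤ B * |φ R| := by positivity
  rcases le_total (l * a) ε with h | h
  · have h1 : -φ (a / 2) ≤ (4 : ℝ) ^ q * (-φ (l * a)) := by
      rw [hsing _ hla0 h, hsing _ (by positivity) (by nlinarith), neg_neg, neg_neg]
      have h2 : a / 2 = (2 * l)⁻¹ * (l * a) := by field_simp
      rw [h2, Real.mul_rpow (by positivity) hla0.le, Real.inv_rpow (by positivity),
        Real.rpow_neg (by positivity) q, inv_inv]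
      gcongr
      linarith
    linarith
  · have h1 : φ (ε / 4) ≤ φ (a / 2) := by
      refine hmono.monotoneOn (show 0 < ε / 4 by positivity) (show 0 < a / 2 by positivity) ?_
      nlinarith
    linarith [neg_abs_le (φ (ε / 4))]

lemma sub_ge_of_concave_of_strictMono (hconc : ConcaveOn ℝ (Ioi 0) φ) {R a b t : ℝ}
    (hmono : StrictMonoOn φ (Ioi 0)) (ha : 0 < a) (ht : 0 < t) (hab : a + t ≤ b) (hb : b ≤ R) :
    t * (φ (R + 1) - φ R) ≤ φ b - φ a := by
  have hat : φ (a + t) ≤ φ b :=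
    hmono.monotoneOn (show 0 < a + t by linarith) (show 0 < b by linarith) hab
  have hs : (φ (R + 1) - φ R) / (R + 1 - R) ≤ (φ (a + t) - φ a) / (a + t - a) := by
    rcases eq_or_lt_of_le (hab.trans hb) with h | h
    · rw [← h]
      exact hconc.slope_anti_adjacent ha (show 0 < a + t + 1 by linarith) (by linarith)
        (by linarith)
    · exact (hconc.slope_anti_adjacent (show 0 < a + t by linarith)
        (show 0 < R + 1 by linarith) h (by linarith)).trans
        (hconc.slope_anti_adjacent ha (show 0 < R by linarith) (by linarith) h)
  rw [div_le_div_iff₀ (by linarith) (by linarith)] at hs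
  nlinarith

end Density

/-! ### Energy decrease -/

lemma integrable_density {n : ℕ} {μ : Measure (Eu n)} [IsFiniteMeasure μ]
    (hμ : ∀ᵐ u ∂μ, u ∈ sphere (0 : Eu n) 1) {φ : ℝ → ℝ} (hφ : ContinuousOn φ (Ioi 0))
    {K : Set (Eu n)} (hK : IsCompact K) {η : Eu n} (hη : η ∈ interior K) {l : ℝ} (hl : 0 < l) :
    Integrable (fun u => φ (l * (suppFn K u - ⟪u, η⟫))) μ := by
  have hc := continuous_suppFn hK ⟨η, interior_subset hη⟩
  rw [← Measure.restrict_eq_self_of_ae_mem hμ]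
  refine ContinuousOn.integrableOn_compact (isCompact_sphere _ _) ?_
  refine hφ.comp (by fun_prop) fun u hu => ?_
  have hu0 : u ≠ 0 := by
    rintro rfl
    simp at hu
  have h1 := inner_lt_suppFn hK hη hu0
  rw [real_inner_comm] at h1
  exact mul_pos hl (sub_pos.2 h1)

open scoped Pointwise in
lemma suppFn_smul_left {n : ℕ} {K : Set (Eu n)} (hK : IsCompact K) (hne : K.Nonempty) {l : ℝ}
    (hl : 0 < l) (u : Eu n) : suppFn (l • K) u = l * suppFn K u := by
  apply le_antisymm
  · refine suppFn_le hne.smul_set ?_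
    rintro _ ⟨x, hx, rfl⟩
    simp only [real_inner_smul_left]
    exact mul_le_mul_of_nonneg_left (inner_le_suppFn hK hx u) hl.le
  · obtain ⟨x, hx, h⟩ := exists_inner_eq_suppFn hK hne u
    rw [← h, ← real_inner_smul_left]
    exact inner_le_suppFn (hK.smul l) (smul_mem_smul_set hx) u

open scoped Pointwise in
lemma phiE_smul {n : ℕ} {μ : Measure (Eu n)} {φ : ℝ → ℝ} {K : Set (Eu n)} (hK : IsCompact K)
    (hne : K.Nonempty) {l : ℝ} (hl : 0 < l) (η : Eu n) :
    PhiE μ φ (l • K) (l • η) = ∫ u, φ (l * (suppFn K u - ⟪u, η⟫)) ∂μ := by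
  unfold PhiE
  congr 1
  funext u
  rw [suppFn_smul_left hK hne hl, real_inner_smul_right, mul_sub]

lemma exists_normalizing_factor (m : ℕ) {v : ℝ} (hv : 1 / 2 ≤ v) (hv1 : v ≤ 1) :
    ∃ l : ℝ, 1 ≤ l ∧ l ≤ 2 ∧ l - 1 ≤ 2 * (1 - v) ∧ l ^ (m + 1) * v = 1 := by
  have hv0 : 0 < v := by linarith
  have hvi : 1 ≤ v⁻¹ := (one_le_inv₀ hv0).2 hv1
  set l : ℝ := v⁻¹ ^ (((m + 1 : ℕ) : ℝ)⁻¹) with hl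
  have hl1 : 1 ≤ l := Real.one_le_rpow hvi (by positivity)
  have hlp : l ^ (m + 1) = v⁻¹ := Real.rpow_inv_natCast_pow (by positivity) (by simp)
  have hlv : l ≤ v⁻¹ := hlp ▸ le_self_pow₀ hl1 (by simp)
  have h1 : v⁻¹ - 1 ≤ 2 * (1 - v) := by
    rw [inv_eq_one_div, div_sub_one hv0.ne', div_le_iff₀ hv0]
    nlinarith
  exact ⟨l, hl1, by linarith, by linarith, by rw [hlp, inv_mul_cancel₀ hv0.ne']⟩

open scoped Pointwise in
lemma exists_lower_energy {m : ℕ} {μ : Measure (Eu (m + 1))} [IsFiniteMeasure μ]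
    (hμ : ∀ᵐ u ∂μ, u ∈ sphere (0 : Eu (m + 1)) 1) {ε q : ℝ} {φ : ℝ → ℝ}
    (hmono : StrictMonoOn φ (Ioi 0)) (hconc : ConcaveOn ℝ (Ioi 0) φ)
    (hcont : ContinuousOn φ (Ioi 0)) (hε : 0 < ε) (hq : 0 ≤ q)
    (hsing : ∀ t : ℝ, 0 < t → t ≤ ε → φ t = -(t ^ (-q)))
    {L ω : Set (Eu (m + 1))} (hconv : Convex ℝ L) (hL : IsCompact L) {r : ℝ} (hr : 0 < r)
    (hball : closedBall 0 r ⊆ L) (hvol : volume L = 1) (hω : IsClosed ω)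
    (hωs : ω ⊆ sphere 0 1) (hωμ : 0 < μ ω) (hnull : surfMeas L ω = 0) :
    ∃ K' : Set (Eu (m + 1)), IsConvexBody K' ∧ volume K' = 1 ∧ (0 : Eu (m + 1)) ∈ interior K' ∧
      ∀ ξ ∈ interior K', PhiE μ φ K' 0 ≤ PhiE μ φ K' ξ →
        ∃ η ∈ interior L, PhiE μ φ K' ξ < PhiE μ φ L η := by
  obtain ⟨R, hR0, hR⟩ := hL.isBounded.exists_pos_norm_le
  obtain ⟨A, B, hB0, hAB⟩ := exists_dilation_bound hmono hconc hε hq hsing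
    (R := 4 * R) (by positivity)
  set κ : ℝ := φ (2 * R + 1) - φ (2 * R) with hκ
  have hκ0 : 0 < κ := sub_pos.2 (hmono (show 0 < 2 * R by positivity)
    (show 0 < 2 * R + 1 by positivity) (by linarith))
  have hw0 : 0 < μ.real ω := ENNReal.toReal_pos hωμ.ne' (measure_ne_top _ _)
  set M : ℝ := |φ (r / 2)| * μ.real univ with hM
  set D : ℝ := A * μ.real univ + B * M with hD
  set δ : ℝ := κ * μ.real ω / (2 * (|D| + 1)) with hδ
  have hδ0 : 0 < δ := by positivity
  obtain ⟨t₀, ht₀, hloss⟩ := volume_diff_shrink_le hconv hL hr hball hω hωs hnull hδ0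
  obtain ⟨t, ht, htt₀, htr, htδ⟩ : ∃ t, 0 < t ∧ t < t₀ ∧ t ≤ r / 2 ∧ δ * t ≤ 1 / 2 := by
    refine ⟨min (t₀ / 2) (min (r / 2) (1 / (2 * δ))), by positivity, ?_, ?_, ?_⟩
    · exact (min_le_left _ _).trans_lt (by linarith)
    · exact (min_le_right _ _).trans (min_le_left _ _)
    · calc δ * min (t₀ / 2) (min (r / 2) (1 / (2 * δ))) ≤ δ * (1 / (2 * δ)) := by
            gcongr
            exact (min_le_right _ _).trans (min_le_right _ _)
        _ = 1 / 2 := by field_simp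
  set S := shrink L ω t with hS
  have hSL : S ⊆ L := shrink_subset t
  have hSc : IsCompact S := isCompact_shrink hL t
  have hballS : closedBall 0 (r / 2) ⊆ S :=
    (closedBall_subset_closedBall (by linarith)).trans
      (closedBall_subset_shrink hL hωs hr.le hball ht.le)
  have h0S : (0 : Eu (m + 1)) ∈ interior S :=
    interior_mono hballS (ball_subset_interior_closedBall (mem_ball_self (by positivity)))
  have hSne : S.Nonempty := ⟨0, interior_subset h0S⟩
  have hLne : L.Nonempty := hSne.mono hSL
  have hvle : volume.real S ≤ 1 := by
    have := measureReal_mono (μ := volume) hSL (by rw [hvol]; exact ENNReal.one_ne_top)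
    rwa [measureReal_def volume L, hvol, ENNReal.toReal_one] at this
  have hvge : 1 - δ * t ≤ volume.real S := by
    have h1 : volume.real (L \ S) ≤ δ * t := ENNReal.toReal_le_of_le_ofReal (by positivity)
      (hloss t ht htt₀)
    have h2 : volume.real (L \ S) = volume.real L - volume.real S :=
      measureReal_sdiff hSL hSc.isClosed.measurableSet
        (by rw [hvol]; exact ENNReal.one_ne_top)
    have h3 : volume.real L = 1 := by rw [measureReal_def, hvol, ENNReal.toReal_one]
    linarith
  obtain ⟨l, hl1, hl2, hlle, hlv⟩ := exists_normalizing_factor m (by linarith) hvle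
  have hl0 : 0 < l := by linarith
  have h_int : interior (l • S) = l • interior S := interior_smul₀ hl0.ne' S
  refine ⟨l • S, ⟨(convex_shrink hconv t).smul l, hSc.smul l, ?_⟩, ?_, ?_, ?_⟩
  · rw [h_int]
    exact ⟨l • (0 : Eu (m + 1)), smul_mem_smul_set h0S⟩
  · rw [Measure.addHaar_smul, finrank_euclideanSpace_fin, abs_of_nonneg (by positivity),
      ← ENNReal.ofReal_toReal (hSc.measure_lt_top (μ := volume)).ne, ← ENNReal.ofReal_mul (by positivity)]
    rw [measureReal_def] at hlv
    rw [hlv, ENNReal.ofReal_one]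
  · rw [h_int]
    exact ⟨0, h0S, smul_zero l⟩
  rw [h_int]
  rintro _ ⟨η, hη, rfl⟩ hmax
  have hηL : η ∈ interior L := interior_mono hSL hη
  refine ⟨η, hηL, ?_⟩
  have hlow : -M ≤ PhiE μ φ (l • S) 0 := by
    have h1 := phiE_smul (μ := μ) (φ := φ) hSc hSne hl0 0
    rw [smul_zero] at h1
    rw [h1]
    have h2 : ∫ _, -|φ (r / 2)| ∂μ ≤ ∫ u, φ (l * (suppFn S u - ⟪u, (0 : Eu (m + 1))⟫)) ∂μ := by
      refine integral_mono_ae (integrable_const _) (integrable_density hμ hcont hSc h0S hl0) ?_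
      filter_upwards [hμ] with u hu
      have h3 := le_suppFn_of_closedBall_subset hSc (by positivity) hballS
        (u := u) (by simpa using hu)
      refine (neg_abs_le _).trans (hmono.monotoneOn (show 0 < r / 2 by positivity)
        (mem_Ioi.2 ?_) ?_)
      · rw [inner_zero_right]
        have : 0 < r / 2 := by positivity
        exact mul_pos hl0 (by linarith)
      · rw [inner_zero_right]
        nlinarith
    rw [integral_const, smul_eq_mul] at h2
    rw [hM]
    linarith
  set P := PhiE μ φ (l • S) (l • η) with hP
  have hPge : -M ≤ P := hlow.trans hmax
  have hPeq : P = ∫ u, φ (l * (suppFn S u - ⟪u, η⟫)) ∂μ := phiE_smul hSc hSne hl0 η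
  have hi1 := integrable_density hμ hcont hSc hη hl0
  have hi2 : Integrable (fun u => φ (suppFn L u - ⟪u, η⟫)) μ := by
    simpa using integrable_density hμ hcont hL hηL one_pos
  have hi3 : Integrable (ω.indicator fun _ => t * κ) μ :=
    (integrable_const _).indicator hω.measurableSet
  have hi4 : Integrable (fun u => (l - 1) * (A - B * φ (l * (suppFn S u - ⟪u, η⟫)))) μ :=
    ((integrable_const A).sub (hi1.const_mul B)).const_mul (l - 1)
  have hpt : ∀ᵐ u ∂μ, φ (l * (suppFn S u - ⟪u, η⟫)) - φ (suppFn L u - ⟪u, η⟫) ≤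
      (l - 1) * (A - B * φ (l * (suppFn S u - ⟪u, η⟫))) - ω.indicator (fun _ => t * κ) u := by
    filter_upwards [hμ] with u hu
    have hu1 : ‖u‖ = 1 := by simpa using hu
    have hu0 : u ≠ 0 := by
      rintro rfl
      simp at hu1
    have hnorm : ∀ x ∈ L, |⟪x, u⟫| ≤ R := fun x hx =>
      (abs_real_inner_le_norm x u).trans (by rw [hu1, mul_one]; exact hR x hx)
    have ha : 0 < suppFn S u - ⟪u, η⟫ := by
      rw [real_inner_comm]
      exact sub_pos.2 (inner_lt_suppFn hSc hη hu0)
    have hSLu : suppFn S u ≤ suppFn L u :=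
      suppFn_le hSne fun x hx => inner_le_suppFn hL (hSL hx) u
    have hb : suppFn L u - ⟪u, η⟫ ≤ 2 * R := by
      have h1 : suppFn L u ≤ R := suppFn_le hLne fun x hx => (abs_le.1 (hnorm x hx)).2
      have h2 := (abs_le.1 (hnorm η (interior_subset hηL))).1
      rw [real_inner_comm] at h2
      linarith
    have h1 := hAB l _ hl1 hl2 ha (by nlinarith)
    by_cases huω : u ∈ ω
    · rw [indicator_of_mem huω]
      have h2 : suppFn S u ≤ suppFn L u - t := suppFn_le hSne fun x hx => hx.2 u huω
      have h3 := sub_ge_of_concave_of_strictMono hconc hmono ha ht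
        (b := suppFn L u - ⟪u, η⟫) (by linarith) hb
      linarith
    · rw [indicator_of_notMem huω]
      have h2 : φ (suppFn S u - ⟪u, η⟫) ≤ φ (suppFn L u - ⟪u, η⟫) :=
        hmono.monotoneOn ha (mem_Ioi.2 (by linarith)) (by linarith)
      linarith
  have hmain := integral_mono_ae (hi1.sub hi2) (hi4.sub hi3) hpt
  rw [integral_sub' hi1 hi2, integral_sub' hi4 hi3, ← hPeq, integral_const_mul,
    integral_sub (integrable_const A) (hi1.const_mul B), integral_const_mul, ← hPeq,
    integral_const, integral_indicator_const _ hω.measurableSet, smul_eq_mul, smul_eq_mul] at hmain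
  change P - PhiE μ φ L η ≤ _ at hmain
  have h1 : (l - 1) * (μ.real univ * A - B * P) ≤ (l - 1) * |D| := by
    refine mul_le_mul_of_nonneg_left ((?_ : _ ≤ D).trans (le_abs_self D)) (by linarith)
    rw [hD]
    nlinarith
  have h2 : (l - 1) * |D| ≤ 2 * (δ * t) * |D| :=
    mul_le_mul_of_nonneg_right (by linarith) (abs_nonneg _)
  have h3 : 2 * δ * (|D| + 1) = κ * μ.real ω := by
    rw [hδ]
    field_simp
  have h4 : 2 * (δ * t) * |D| < t * (κ * μ.real ω) := by
    rw [← h3]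
    nlinarith [mul_pos hδ0 ht]
  linarith

/-! ### Translations -/

section Translate

variable {n : ℕ} {K : Set (Eu n)} (c : Eu n)

lemma isCompact_translate (hK : IsCompact K) : IsCompact ((· + c) ⁻¹' K) :=
  (Homeomorph.addRight c).isCompact_preimage.2 hK

lemma interior_translate : interior ((· + c) ⁻¹' K) = (· + c) ⁻¹' interior K :=
  ((Homeomorph.addRight c).preimage_interior K).symm

lemma suppFn_translate (hK : IsCompact K) (hne : K.Nonempty) (u : Eu n) :
    suppFn ((· + c) ⁻¹' K) u = suppFn K u - ⟪c, u⟫ := by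
  obtain ⟨x, hx, h⟩ := exists_inner_eq_suppFn hK hne u
  have hx' : x - c ∈ (· + c) ⁻¹' K := by simpa using hx
  apply le_antisymm
  · refine suppFn_le ⟨_, hx'⟩ fun y hy => ?_
    have h1 := inner_le_suppFn hK hy u
    rw [inner_add_left] at h1
    linarith
  · rw [← h, ← inner_sub_left]
    exact inner_le_suppFn (isCompact_translate c hK) hx' u

lemma phiE_translate (hK : IsCompact K) (hne : K.Nonempty) (μ : Measure (Eu n)) (φ : ℝ → ℝ)
    (η : Eu n) : PhiE μ φ ((· + c) ⁻¹' K) η = PhiE μ φ K (η + c) := by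
  unfold PhiE
  congr 1
  funext u
  rw [suppFn_translate c hK hne, inner_add_right, real_inner_comm u c]
  ring_nf

lemma hausdorffMeasure_translate (d : ℝ) (s : Set (Eu n)) : μH[d] ((· + c) ⁻¹' s) = μH[d] s :=
  (IsometryEquiv.addRight c).hausdorffMeasure_preimage d s

lemma surfMeas_translate (hK : IsCompact K) (hne : K.Nonempty) {ω : Set (Eu n)}
    (hω : ω ⊆ sphere 0 1) : surfMeas ((· + c) ⁻¹' K) ω = surfMeas K ω := by
  rw [surfMeas_eq (isCompact_translate c hK) hω, surfMeas_eq hK hω,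
    ← hausdorffMeasure_translate c _ {x ∈ K | _}]
  congr 1
  ext x
  simp only [mem_preimage, mem_ofPred_eq, suppFn_translate c hK hne, inner_add_left,
    eq_sub_iff_add_eq]

end Translate

/-! ### Singular points and faces -/

lemma eq_of_subgradient {n : ℕ} {g : Eu n → ℝ} {x v w : Eu n} (hg : DifferentiableAt ℝ g x)
    (hv : ∀ y, ⟪v, y⟫ ≤ g y) (hvx : ⟪v, x⟫ = g x) (hw : ∀ y, ⟪w, y⟫ ≤ g y)
    (hwx : ⟪w, x⟫ = g x) : v = w := by
  have key : ∀ z : Eu n, (∀ y, ⟪z, y⟫ ≤ g y) → ⟪z, x⟫ = g x → fderiv ℝ g x = innerSL ℝ z := by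
    intro z hz hzx
    have hmin : IsLocalMin (fun y => g y - innerSL ℝ z y) x := by
      refine Filter.Eventually.of_forall fun y => ?_
      simp only [innerSL_apply_apply, hzx, sub_self]
      exact sub_nonneg.2 (hz y)
    have h := hmin.hasFDerivAt_eq_zero (hg.hasFDerivAt.sub (innerSL ℝ z).hasFDerivAt)
    exact sub_eq_zero.1 h
  refine ext_inner_right ℝ fun y => ?_
  have h := congrArg (fun T => T y) ((key v hv hvx).symm.trans (key w hw hwx))
  simpa using h

lemma hausdorffMeasure_not_differentiableAt_inter {m : ℕ} {f g : Eu (m + 1) → ℝ} {C C' : ℝ≥0}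
    (hf : LipschitzWith C f) (hfhom : ∀ (c : ℝ) x, 0 < c → f (c • x) = c * f x)
    (hg : LipschitzWith C' g) (hghom : ∀ (c : ℝ) x, 0 < c → g (c • x) = c * g x) :
    μH[((m + 1 : ℕ) : ℝ) - 1] ({x | ¬DifferentiableAt ℝ f x} ∩ {x | g x = 1}) = 0 := by
  refine hausdorffMeasure_cone_inter_null (ae_iff.1 (hf.ae_differentiableAt (μ := volume)))
    (fun x hx c hc hd => hx ?_) hg hghom
  have h1 : f = fun y => c⁻¹ * f (c • y) := by
    funext y
    rw [hfhom c y hc, inv_mul_cancel_left₀ hc.ne']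
  rw [h1]
  have h2 : DifferentiableAt ℝ (fun y : Eu (m + 1) => f (c • y)) x :=
    DifferentiableAt.comp x hd (by fun_prop)
  exact h2.const_mul _

lemma hausdorffMeasure_singular_zero_mem {m : ℕ} {L : Set (Eu (m + 1))} (hconv : Convex ℝ L)
    (hL : IsCompact L) (h0 : (0 : Eu (m + 1)) ∈ interior L) :
    μH[((m + 1 : ℕ) : ℝ) - 1] {x ∈ L | ∃ u v, u ≠ v ∧ IsOuterNormal L x u ∧
      IsOuterNormal L x v} = 0 := by
  have hnhds : L ∈ nhds (0 : Eu (m + 1)) := mem_interior_iff_mem_nhds.1 h0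
  obtain ⟨C, hC⟩ := hconv.lipschitz_gauge hnhds
  have hhom : ∀ (c : ℝ) (x : Eu (m + 1)), 0 < c → gauge L (c • x) = c * gauge L x :=
    fun c x hc => gauge_smul_of_nonneg hc.le x
  refine measure_mono_null ?_ (hausdorffMeasure_not_differentiableAt_inter hC hhom hC hhom)
  rintro x ⟨hx, u, v, huv, hu, hv⟩
  have hx1 : gauge L x = 1 :=
    (gauge_eq_one_iff_mem_frontier hconv hnhds).2 (hu.mem_frontier hL hx)
  have hpos : ∀ w, IsOuterNormal L x w → 0 < suppFn L w := by
    intro w hw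
    have h := inner_lt_suppFn hL h0 (u := w) (norm_ne_zero_iff.1 (by rw [hw.1]; simp))
    rwa [inner_zero_left] at h
  have hsub : ∀ w, IsOuterNormal L x w → ∀ y, ⟪(suppFn L w)⁻¹ • w, y⟫ ≤ gauge L y := by
    intro w hw y
    rw [real_inner_smul_left, inv_mul_le_iff₀ (hpos w hw)]
    refine le_of_forall_pos_le_add fun e he => ?_
    have he' : 0 < e / suppFn L w := div_pos he (hpos w hw)
    obtain ⟨b, hb0, hb, z, hz, rfl⟩ := exists_lt_of_gauge_lt (absorbent_nhds_zero hnhds)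
      (lt_add_of_pos_right (gauge L y) he')
    have h1 := inner_le_suppFn hL hz w
    rw [real_inner_smul_right, real_inner_comm]
    calc b * ⟪z, w⟫ ≤ b * suppFn L w := mul_le_mul_of_nonneg_left h1 hb0.le
      _ ≤ (gauge L (b • z) + e / suppFn L w) * suppFn L w :=
        mul_le_mul_of_nonneg_right hb.le (hpos w hw).le
      _ = suppFn L w * gauge L (b • z) + e := by
        rw [add_mul, div_mul_cancel₀ _ (hpos w hw).ne', mul_comm]
  have heq : ∀ w, IsOuterNormal L x w → ⟪(suppFn L w)⁻¹ • w, x⟫ = gauge L x := by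
    intro w hw
    rw [real_inner_smul_left, real_inner_comm, ((isOuterNormal_iff hL hx).1 hw).2, hx1,
      inv_mul_cancel₀ (hpos w hw).ne']
  refine ⟨fun hd => huv ?_, hx1⟩
  have h1 := eq_of_subgradient hd (hsub u hu) (heq u hu) (hsub v hv) (heq v hv)
  have h2 : (suppFn L u)⁻¹ = (suppFn L v)⁻¹ := by
    have h := congrArg norm h1
    rwa [norm_smul, norm_smul, hu.1, hv.1, mul_one, mul_one, Real.norm_of_nonneg
      (inv_nonneg.2 (hpos u hu).le), Real.norm_of_nonneg (inv_nonneg.2 (hpos v hv).le)] at h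
  rw [h2] at h1
  exact smul_right_injective _ (inv_pos.2 (hpos v hv)).ne' h1

lemma hausdorffMeasure_singular {m : ℕ} {K : Set (Eu (m + 1))} (hK : IsConvexBody K) :
    μH[((m + 1 : ℕ) : ℝ) - 1] {x ∈ K | ∃ u v, u ≠ v ∧ IsOuterNormal K x u ∧
      IsOuterNormal K x v} = 0 := by
  obtain ⟨hconv, hc, x₀, hx₀⟩ := hK
  rw [← hausdorffMeasure_translate x₀]
  have h0 : (0 : Eu (m + 1)) ∈ interior ((· + x₀) ⁻¹' K) := by
    rw [interior_translate]
    simpa using hx₀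
  refine measure_mono_null ?_ (hausdorffMeasure_singular_zero_mem
    (hconv.translate_preimage_left x₀) (isCompact_translate x₀ hc) h0)
  rintro x ⟨hx, u, v, huv, hu, hv⟩
  have key : ∀ w, IsOuterNormal K (x + x₀) w → IsOuterNormal ((· + x₀) ⁻¹' K) x w := by
    refine fun w hw => ⟨hw.1, fun y hy => ?_⟩
    have h := hw.2 _ hy
    rw [inner_add_left, inner_add_left] at h
    linarith
  exact ⟨hx, u, v, huv, key u hu, key v hv⟩

lemma hausdorffMeasure_faces {m : ℕ} {K : Set (Eu (m + 1))} (hK : IsCompact K)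
    (hne : K.Nonempty) :
    μH[((m + 1 : ℕ) : ℝ) - 1] {u ∈ sphere (0 : Eu (m + 1)) 1 | ∃ x ∈ K, ∃ y ∈ K, x ≠ y ∧
      ⟪x, u⟫ = suppFn K u ∧ ⟪y, u⟫ = suppFn K u} = 0 := by
  obtain ⟨C, hC⟩ := lipschitzWith_suppFn hK hne
  refine measure_mono_null ?_ (hausdorffMeasure_not_differentiableAt_inter hC
    (fun c x hc => suppFn_smul_right hK hne hc x) lipschitzWith_one_norm
    (fun c x hc => by rw [norm_smul, Real.norm_of_nonneg hc.le]))
  rintro u ⟨hu, x, hx, y, hy, hxy, hxu, hyu⟩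
  refine ⟨fun hd => hxy ?_, by simpa using hu⟩
  exact eq_of_subgradient hd (inner_le_suppFn hK hx) hxu (inner_le_suppFn hK hy) hyu

lemma isClosed_separatedNormals {n : ℕ} {K : Set (Eu n)} (hK : IsCompact K) (hne : K.Nonempty)
    (d : ℝ) :
    IsClosed {u ∈ sphere (0 : Eu n) 1 | ∃ x ∈ K, ∃ v ∈ sphere (0 : Eu n) 1,
      ⟪x, u⟫ = suppFn K u ∧ ⟪x, v⟫ = suppFn K v ∧ d ≤ ‖u - v‖} := by
  have hc := continuous_suppFn hK hne
  have hS := isCompact_sphere (0 : Eu n) 1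
  have hcl : IsClosed {z : Eu n × Eu n × Eu n | ⟪z.2.1, z.1⟫ = suppFn K z.1 ∧
      ⟪z.2.1, z.2.2⟫ = suppFn K z.2.2 ∧ d ≤ ‖z.1 - z.2.2‖} := by
    refine IsClosed.and (isClosed_eq ?_ ?_) (IsClosed.and (isClosed_eq ?_ ?_) (isClosed_le ?_ ?_))
    all_goals fun_prop
  have hcomp := (((hS.prod (hK.prod hS)).inter_right hcl).image continuous_fst).isClosed
  refine (congrArg IsClosed ?_).mpr hcomp
  ext u
  constructor
  · rintro ⟨hu, x, hx, v, hv, h⟩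
    exact ⟨(u, x, v), ⟨⟨hu, hx, hv⟩, h⟩, rfl⟩
  · rintro ⟨⟨u', x, v⟩, ⟨⟨hu, hx, hv⟩, h⟩, rfl⟩
    exact ⟨hu, x, hx, v, hv, h⟩

lemma exists_isClosed_surfMeas_eq_zero {m : ℕ} {K : Set (Eu (m + 1))} (hK : IsConvexBody K)
    (hq : ¬QuasiSmooth K) :
    ∃ ω : Set (Eu (m + 1)), IsClosed ω ∧ ω ⊆ sphere 0 1 ∧
      0 < μH[((m + 1 : ℕ) : ℝ) - 1] ω ∧ surfMeas K ω = 0 := by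
  have hc := hK.2.1
  have hne : K.Nonempty := hK.2.2.mono interior_subset
  set ν : Measure (Eu (m + 1)) := μH[((m + 1 : ℕ) : ℝ) - 1] with hν
  set F : ℕ → Set (Eu (m + 1)) := fun k => {u ∈ sphere (0 : Eu (m + 1)) 1 | ∃ x ∈ K,
    ∃ v ∈ sphere (0 : Eu (m + 1)) 1, ⟪x, u⟫ = suppFn K u ∧ ⟪x, v⟫ = suppFn K v ∧
      1 / ((k : ℝ) + 1) ≤ ‖u - v‖} with hF
  have hFs : ∀ k, F k ⊆ sphere 0 1 := fun k u hu => hu.1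
  obtain ⟨k, hk⟩ : ∃ k, ν (F k) ≠ 0 := by
    by_contra! hcon
    refine hq (measure_mono_null ?_ (measure_iUnion_null hcon))
    rintro u ⟨hu, hns⟩
    have hu1 : ‖u‖ = 1 := by simpa using hu
    obtain ⟨x, hx, hxu⟩ := exists_inner_eq_suppFn hc hne u
    have hnx : IsOuterNormal K x u := (isOuterNormal_iff hc hx).2 ⟨hu1, hxu⟩
    obtain ⟨v, hv, hvu⟩ : ∃ v, IsOuterNormal K x v ∧ v ≠ u := by
      by_contra! hcon'
      exact hns ⟨x, hnx.mem_frontier hc hx, ⟨u, hnx, hcon'⟩, hnx⟩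
    obtain ⟨k, hk⟩ := exists_nat_one_div_lt (norm_pos_iff.2 (sub_ne_zero.2 hvu.symm))
    exact mem_iUnion.2 ⟨k, hu, x, hx, v, by simpa using hv.1, hxu,
      ((isOuterNormal_iff hc hx).1 hv).2, hk.le⟩
  have hFcl : IsClosed (F k) := isClosed_separatedNormals hc hne _
  set T := toMeasurable ν {u ∈ sphere (0 : Eu (m + 1)) 1 | ∃ x ∈ K, ∃ y ∈ K, x ≠ y ∧
      ⟪x, u⟫ = suppFn K u ∧ ⟪y, u⟫ = suppFn K u} with hT
  have hT0 : ν T = 0 := (measure_toMeasurable _).trans (hausdorffMeasure_faces hc hne)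
  have hmeas : MeasurableSet (F k \ T) := hFcl.measurableSet.diff (measurableSet_toMeasurable _ _)
  have hpos : 0 < ν (F k \ T) := by
    rw [measure_sdiff_null hT0]
    exact pos_iff_ne_zero.2 hk
  have : IsFiniteMeasure (ν.restrict (sphere (0 : Eu (m + 1)) 1)) :=
    ⟨by rw [Measure.restrict_apply_univ]; exact hausdorffMeasure_sphere_lt_top m⟩
  have hres : ∀ s, s ⊆ F k → ν.restrict (sphere (0 : Eu (m + 1)) 1) s = ν s := fun s hs => by
    rw [Measure.restrict_apply' isClosed_sphere.measurableSet,
      inter_eq_self_of_subset_left (hs.trans (hFs k))]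
  rw [← hres _ sdiff_subset] at hpos
  obtain ⟨ω, hωF, hωc, hω⟩ := hmeas.exists_lt_isClosed_of_ne_top (measure_ne_top _ _) hpos
  have hωF' : ω ⊆ F k := hωF.trans sdiff_subset
  rw [hres ω hωF'] at hω
  refine ⟨ω, hωc, hωF'.trans (hFs k), hω, ?_⟩
  rw [surfMeas_eq hc (hωF'.trans (hFs k))]
  refine measure_mono_null ?_ (hausdorffMeasure_singular hK)
  rintro x ⟨hx, u, huω, hxu⟩
  obtain ⟨hu, y, hy, v, hv, hyu, hyv, huv⟩ := hωF' huω
  have hxy : x = y := by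
    by_contra hxy
    exact (hωF huω).2 (subset_toMeasurable _ _ ⟨hu, x, hx, y, hy, hxy, hxu, hyu⟩)
  subst hxy
  refine ⟨hx, u, v, ?_, (isOuterNormal_iff hc hx).2 ⟨by simpa using hu, hxu⟩,
    (isOuterNormal_iff hc hx).2 ⟨by simpa using hv, hyv⟩⟩
  rintro rfl
  rw [sub_self, norm_zero] at huv
  exact absurd huv (not_le.2 (by positivity))

lemma exists_better_body {m : ℕ} {μ : Measure (Eu (m + 1))} [IsFiniteMeasure μ]
    (hμ : ∀ᵐ u ∂μ, u ∈ sphere (0 : Eu (m + 1)) 1) {ε q : ℝ} {φ : ℝ → ℝ}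
    (hmono : StrictMonoOn φ (Ioi 0)) (hconc : ConcaveOn ℝ (Ioi 0) φ)
    (hcont : ContinuousOn φ (Ioi 0)) (hε : 0 < ε) (hq : 0 ≤ q)
    (hsing : ∀ t : ℝ, 0 < t → t ≤ ε → φ t = -(t ^ (-q)))
    {K ω : Set (Eu (m + 1))} (hK : IsConvexBody K) (hvol : volume K = 1) (hω : IsClosed ω)
    (hωs : ω ⊆ sphere 0 1) (hωμ : 0 < μ ω) (hnull : surfMeas K ω = 0) :
    ∃ K' : Set (Eu (m + 1)), IsConvexBody K' ∧ volume K' = 1 ∧ (0 : Eu (m + 1)) ∈ interior K' ∧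
      ∀ ξ ∈ interior K', PhiE μ φ K' 0 ≤ PhiE μ φ K' ξ →
        ∃ η ∈ interior K, PhiE μ φ K' ξ < PhiE μ φ K η := by
  obtain ⟨hconv, hc, x₀, hx₀⟩ := hK
  have hne : K.Nonempty := ⟨x₀, interior_subset hx₀⟩
  have h0 : (0 : Eu (m + 1)) ∈ interior ((· + x₀) ⁻¹' K) := by
    rw [interior_translate]
    simpa using hx₀
  obtain ⟨r, hr, hball⟩ := nhds_basis_closedBall.mem_iff.1 (mem_interior_iff_mem_nhds.1 h0)
  obtain ⟨K', hK', hv', h0', hlt⟩ := exists_lower_energy hμ hmono hconc hcont hε hq hsing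
    (hconv.translate_preimage_left x₀) (isCompact_translate x₀ hc) hr hball
    (by rw [measure_preimage_add_right, hvol]) hω hωs hωμ
    (by rw [surfMeas_translate x₀ hc hne hωs, hnull])
  refine ⟨K', hK', hv', h0', fun ξ hξ hle => ?_⟩
  obtain ⟨η, hη, h⟩ := hlt ξ hξ hle
  rw [interior_translate] at hη
  exact ⟨η + x₀, hη, by rwa [phiE_translate x₀ hc hne] at h⟩

/-! ### Measures with bounded density on the sphere -/

lemma lt_top_withDensity_sphere {m : ℕ} {f : Eu (m + 1) → ℝ} {b : ℝ}
    (hf : ∀ u ∈ sphere (0 : Eu (m + 1)) 1, f u < b) :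
    ((μH[((m + 1 : ℕ) : ℝ) - 1]).restrict (sphere (0 : Eu (m + 1)) 1)).withDensity
      (fun u => ENNReal.ofReal (f u)) univ < ⊤ := by
  rw [withDensity_apply _ MeasurableSet.univ, Measure.restrict_univ]
  refine (setLIntegral_mono' isClosed_sphere.measurableSet
    (g := fun _ => ENNReal.ofReal b) fun u hu => ENNReal.ofReal_le_ofReal (hf u hu).le).trans_lt ?_
  rw [setLIntegral_const]
  exact ENNReal.mul_lt_top ENNReal.ofReal_lt_top (hausdorffMeasure_sphere_lt_top m)

lemma withDensity_sphere_pos {m : ℕ} {f : Eu (m + 1) → ℝ} {a : ℝ} (ha : 0 < a)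
    (hf : ∀ u ∈ sphere (0 : Eu (m + 1)) 1, a < f u) {ω : Set (Eu (m + 1))} (hω : IsClosed ω)
    (hωs : ω ⊆ sphere 0 1) (hpos : 0 < μH[((m + 1 : ℕ) : ℝ) - 1] ω) :
    0 < ((μH[((m + 1 : ℕ) : ℝ) - 1]).restrict (sphere (0 : Eu (m + 1)) 1)).withDensity
      (fun u => ENNReal.ofReal (f u)) ω := by
  rw [withDensity_apply _ hω.measurableSet, Measure.restrict_restrict hω.measurableSet,
    inter_eq_self_of_subset_left hωs]
  refine lt_of_lt_of_le (ENNReal.mul_pos (ENNReal.ofReal_pos.2 ha).ne' hpos.ne') ?_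
  rw [← setLIntegral_const]
  exact setLIntegral_mono' hω.measurableSet fun u hu => ENNReal.ofReal_le_ofReal (hf u (hωs hu)).le

/-- Proposition 5.3 and Corollary 5.4: if `K` has volume one, contains the
origin, and there is a closed `ω ⊆ S^{n-1}` of positive `H^{n-1}`-measure with `S_K(ω) = 0`,
then the energy `Φ_ε(·, ξ(·))` can be strictly decreased within the class `K₁`;
consequently any minimizer of `K ↦ Φ_ε(K, ξ(K))` over `K₁` is quasi-smooth. -/
theorem improve_energy_and_quasi_smooth
    (n : ℕ) (p ε q τ₁ τ₂ : ℝ)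
    (hp : -(n : ℝ) < p ∧ p < 1) (hε : ε ∈ Set.Ioo (0:ℝ) (1/3))
    (hq : q = max |p| ((n : ℝ) - 1))
    (φ : ℝ → ℝ) (hφ : IsPhiEps p ε q φ)
    (hτ : 0 < τ₁ ∧ τ₁ < τ₂)
    (f : Eu n → ℝ) (hf : ∀ u ∈ sphere (0 : Eu n) 1, τ₁ < f u ∧ f u < τ₂)
    (μ : Measure (Eu n))
    (hμ : μ = ((μH[(n:ℝ) - 1]).restrict (sphere (0 : Eu n) 1)).withDensity
      (fun u => ENNReal.ofReal (f u)))
    (ξfun : Set (Eu n) → Eu n)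
    (hξfun : ∀ K : Set (Eu n), IsConvexBody K → ξfun K ∈ interior K ∧
      ∀ η ∈ interior K, PhiE μ φ K η ≤ PhiE μ φ K (ξfun K)) :
    (∀ K : Set (Eu n), IsConvexBody K → volume K = 1 → (0 : Eu n) ∈ K →
      ∀ ω : Set (Eu n), IsClosed ω → ω ⊆ sphere (0 : Eu n) 1 →
        0 < μH[(n:ℝ) - 1] ω → surfMeas K ω = 0 →
        ∃ K' : Set (Eu n), IsConvexBody K' ∧ volume K' = 1 ∧ (0 : Eu n) ∈ K' ∧
          PhiE μ φ K' (ξfun K') < PhiE μ φ K (ξfun K)) ∧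
    (∀ Ks : Set (Eu n), IsConvexBody Ks → volume Ks = 1 → (0 : Eu n) ∈ Ks →
      (∀ K' : Set (Eu n), IsConvexBody K' → volume K' = 1 → (0 : Eu n) ∈ K' →
        PhiE μ φ Ks (ξfun Ks) ≤ PhiE μ φ K' (ξfun K')) →
      QuasiSmooth Ks) := by
  have hstep : ∀ K : Set (Eu n), IsConvexBody K → volume K = 1 →
      ∀ ω : Set (Eu n), IsClosed ω → ω ⊆ sphere (0 : Eu n) 1 →
        0 < μH[(n:ℝ) - 1] ω → surfMeas K ω = 0 →
        ∃ K' : Set (Eu n), IsConvexBody K' ∧ volume K' = 1 ∧ (0 : Eu n) ∈ K' ∧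
          PhiE μ φ K' (ξfun K') < PhiE μ φ K (ξfun K) := by
    intro K hK hvol ω hω hωs hpos hnull
    rcases n with _ | m
    · rw [sphere_eq_empty_of_subsingleton one_ne_zero] at hωs
      rw [subset_empty_iff.1 hωs, measure_empty] at hpos
      exact absurd hpos (lt_irrefl _)
    obtain ⟨hmono, hconc, hdiff, -, -, hsing, -⟩ := hφ
    have : IsFiniteMeasure μ := ⟨hμ ▸ lt_top_withDensity_sphere fun u hu => (hf u hu).2⟩
    have hae : ∀ᵐ u ∂μ, u ∈ sphere (0 : Eu (m + 1)) 1 := by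
      rw [hμ]
      exact (withDensity_absolutelyContinuous _ _).ae_le
        (ae_restrict_mem isClosed_sphere.measurableSet)
    have hωμ : 0 < μ ω := hμ ▸ withDensity_sphere_pos hτ.1 (fun u hu => (hf u hu).1) hω hωs hpos
    have hcont : ContinuousOn φ (Ioi 0) := fun t ht =>
      (hdiff t ht).1.continuousAt.continuousWithinAt
    obtain ⟨K', hK', hv', h0', hlt⟩ := exists_better_body hae hmono hconc.concaveOn hcont hε.1
      (hq ▸ (abs_nonneg p).trans (le_max_left _ _)) hsing hK hvol hω hωs hωμ hnull
    obtain ⟨hξ, hmax⟩ := hξfun K' hK'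
    obtain ⟨η, hη, h⟩ := hlt _ hξ (hmax 0 h0')
    exact ⟨K', hK', hv', interior_subset h0', h.trans_le ((hξfun K hK).2 η hη)⟩
  refine ⟨fun K hK hvol _ => hstep K hK hvol, fun K hK hvol _ hmin => ?_⟩
  by_contra hq'
  obtain ⟨ω, hω, hωs, hpos, hnull⟩ : ∃ ω : Set (Eu n), IsClosed ω ∧ ω ⊆ sphere 0 1 ∧
      0 < μH[(n:ℝ) - 1] ω ∧ surfMeas K ω = 0 := by
    rcases n with _ | m
    · refine absurd (measure_mono_null sdiff_subset ?_) hq'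
      rw [sphere_eq_empty_of_subsingleton one_ne_zero, measure_empty]
    · exact exists_isClosed_surfMeas_eq_zero hK hq'
  obtain ⟨K', hK', hv', h0', h⟩ := hstep K hK hvol ω hω hωs hpos hnull
  exact absurd (hmin K' hK' hv' h0') (not_le.2 h)

end
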